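/- arXiv:0905.4186 — 7 statements merged into one kernel-verified Lean document; each statement's English description precedes it below -/
import Mathlib

section
/- Let p₀, p₁, p₂, p₃ be binary forms of degree d over ℝ with d ≤ 4. Then there exists a nonzero homogeneous polynomial F of degree 2 in four variables over ℝ such that F(p₀(t,s), p₁(t,s), p₂(t,s), p₃(t,s)) = 0 identically as a polynomial in (t,s). (Every rational curve of degree at most 4 lies on a quadric surface.) -/
open MvPolynomial

theorem MvPolynomial.finrank_homogeneousSubmodule (σ K : Type*) [Fintype σ] [Field K] (n : ℕ) :
    Module.finrank K (homogeneousSubmodule σ K n) = (Fintype.card σ).multichoose n := by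
  classical
  let e : Sym σ n ≃ {m : σ →₀ ℕ | m.degree = n} := Sym.equivNatSum σ n
  have : Fintype {m : σ →₀ ℕ | m.degree = n} := Fintype.ofEquiv _ e
  rw [homogeneousSubmodule_eq_finsupp_supported,
    (AddMonoidAlgebra.supportedEquivFinsupp {m : σ →₀ ℕ | m.degree = n}).finrank_eq,
    Module.finrank_finsupp_self, ← Fintype.card_congr e, Sym.card_sym_eq_multichoose]

/-- Every rational curve of degree at most 4 lies on a quadric surface:
given four real binary forms of degree `d ≤ 4`, there is a nonzero homogeneous
polynomial `F` of degree 2 in four variables vanishing identically on the curve. -/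
theorem quartic_curve_lies_on_quadric
    (d : ℕ) (hd : d ≤ 4)
    (p : Fin 4 → MvPolynomial (Fin 2) ℝ)
    (hp : ∀ i, (p i).IsHomogeneous d) :
    ∃ F : MvPolynomial (Fin 4) ℝ, F ≠ 0 ∧ F.IsHomogeneous 2 ∧
      MvPolynomial.aeval p F = 0 := by
  have (σ : Type) [Finite σ] (n : ℕ) : Module.Finite ℝ (homogeneousSubmodule σ ℝ n) :=
    Module.Finite.iff_fg.mpr (homogeneousSubmodule_fg σ ℝ n)
  let L : homogeneousSubmodule (Fin 4) ℝ 2 →ₗ[ℝ] homogeneousSubmodule (Fin 2) ℝ (d * 2) :=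
    (aeval p).toLinearMap.restrict fun _ hF ↦ IsHomogeneous.aeval hF p hp
  have hlt : Module.finrank ℝ (homogeneousSubmodule (Fin 2) ℝ (d * 2)) <
      Module.finrank ℝ (homogeneousSubmodule (Fin 4) ℝ 2) := by
    simp only [finrank_homogeneousSubmodule, Fintype.card_fin, Nat.multichoose_two]
    have : Nat.multichoose 4 2 = 10 := by rw [Nat.multichoose_eq]; rfl
    lia
  obtain ⟨F, hF, hF0⟩ := Submodule.exists_mem_ne_zero_of_ne_bot
    (LinearMap.ker_ne_bot_of_finrank_lt (f := L) hlt)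
  exact ⟨F, by simpa using hF0, F.2, congrArg Subtype.val (LinearMap.mem_ker.mp hF)⟩
end

section
/- Let p₀, p₁, p₂, p₃ be binary forms of degree 5 over ℂ, and write p(a) = (p₀(a), p₁(a), p₂(a), p₃(a)) ∈ ℂ⁴ for a ∈ ℂ². Suppose there are vectors a₁, b₁, a₂, b₂, a₃, b₃ ∈ ℂ² ∖ {0} such that: for each i, aᵢ and bᵢ are not proportional, p(aᵢ) ≠ 0, and p(bᵢ) = λᵢ · p(aᵢ) for some nonzero λᵢ ∈ ℂ; and for i ≠ j the vectors p(aᵢ) and p(aⱼ) are not proportional. Then the curve is planar: there exists (c₀,c₁,c₂,c₃) ≠ (0,0,0,0) in ℂ⁴ with c₀p₀ + c₁p₁ + c₂p₂ + c₃p₃ = 0 identically. (A curve of degree 5 having three distinct self-intersections is planar.) -/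
open MvPolynomial

/-- The exponents occurring in a binary form of degree `n`. -/
lemma MvPolynomial.IsHomogeneous.exponent_fin_two {K : Type*} [CommSemiring K] {n : ℕ}
    {F : MvPolynomial (Fin 2) K} (hF : F.IsHomogeneous n) {d : Fin 2 →₀ ℕ}
    (hd : d ∈ F.support) :
    d 0 < n + 1 ∧ d = Finsupp.equivFunOnFinite.symm ![d 0, n - d 0] := by
  have hdeg : d 0 + d 1 = n := by
    rw [hF.degree_eq_sum_deg_support hd, ← Finsupp.degree_apply, Finsupp.degree_eq_sum,
      Fin.sum_univ_two]
  refine ⟨by lia, ?_⟩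
  ext i
  fin_cases i
  · simp
  · simp; lia

/-- Evaluation of a binary form of degree `n`, as a sum over its `n + 1` coefficients. -/
lemma MvPolynomial.IsHomogeneous.eval_fin_two {K : Type*} [CommSemiring K] {n : ℕ}
    {F : MvPolynomial (Fin 2) K} (hF : F.IsHomogeneous n) (x : Fin 2 → K) :
    eval x F = ∑ k : Fin (n + 1),
      F.coeff (Finsupp.equivFunOnFinite.symm ![(k : ℕ), n - k]) * (x 0 ^ (k : ℕ) * x 1 ^ (n - k)) := by
  classical
  rw [eval_eq']
  let m : Fin (n + 1) → (Fin 2 →₀ ℕ) := fun k ↦ Finsupp.equivFunOnFinite.symm ![(k : ℕ), n - k]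
  have hm : Function.Injective m := fun k l h ↦ by
    simpa [m, Fin.val_inj] using DFunLike.congr_fun h 0
  have hsub : F.support ⊆ Finset.univ.image m := fun d hd ↦ by
    obtain ⟨hlt, heq⟩ := hF.exponent_fin_two hd
    exact Finset.mem_image.2 ⟨⟨d 0, hlt⟩, Finset.mem_univ _, heq.symm⟩
  rw [Finset.sum_subset hsub fun d _ hd ↦ by rw [notMem_support_iff.1 hd, zero_mul],
    Finset.sum_image hm.injOn]
  simp [m, Fin.prod_univ_two]

/-- A binary form of degree `n` with `n + 1` pairwise non-proportional zeros vanishes. -/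
lemma MvPolynomial.IsHomogeneous.eq_zero_of_fin_two {K : Type*} [Field K] {n : ℕ}
    {F : MvPolynomial (Fin 2) K} (hF : F.IsHomogeneous n) (x : Fin (n + 1) → Fin 2 → K)
    (hx : ∀ i j, i ≠ j → x j 0 * x i 1 ≠ x i 0 * x j 1) (hzero : ∀ i, eval (x i) F = 0) :
    F = 0 := by
  have hdet : (Matrix.projVandermonde (fun i ↦ x i 0) fun i ↦ x i 1).det ≠ 0 := by
    rw [Matrix.det_projVandermonde]
    refine Finset.prod_ne_zero_iff.2 fun i _ ↦ Finset.prod_ne_zero_iff.2 fun j hj ↦ ?_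
    exact sub_ne_zero.2 (hx i j (Finset.mem_Ioi.1 hj).ne)
  have hcoeff := Matrix.eq_zero_of_mulVec_eq_zero hdet
    (v := fun k : Fin (n + 1) ↦ F.coeff (Finsupp.equivFunOnFinite.symm ![(k : ℕ), n - k])) <| by
      ext i
      rw [Pi.zero_apply, ← hzero i, hF.eval_fin_two, Matrix.mulVec, dotProduct]
      refine Finset.sum_congr rfl fun k _ ↦ ?_
      rw [Matrix.projVandermonde_apply, Fin.val_rev, mul_comm]
      simp
  ext d
  by_contra hd
  obtain ⟨hlt, heq⟩ := hF.exponent_fin_two (mem_support_iff.2 hd)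
  rw [coeff_zero, heq] at hd
  exact hd (congr_fun hcoeff ⟨d 0, hlt⟩)

/-- Nonzero vectors of the plane with vanishing determinant are proportional. -/
lemma exists_eq_smul_of_mul_eq_mul {K : Type*} [Field K] {x y : Fin 2 → K} (hx : x ≠ 0)
    (h : y 0 * x 1 = x 0 * y 1) : ∃ μ : K, y = μ • x := by
  by_cases h0 : x 0 = 0
  · have h1 : x 1 ≠ 0 := fun h1 ↦ hx <| by ext i; fin_cases i <;> simpa
    refine ⟨y 1 / x 1, ?_⟩
    ext i
    fin_cases i
    · simpa [h0, h1] using h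
    · simp [h1]
  · refine ⟨y 0 / x 0, ?_⟩
    ext i
    fin_cases i
    · simp [h0]
    · simp only [Fin.mk_one, Pi.smul_apply, smul_eq_mul]
      field_simp
      linear_combination -h

/-- A homogeneous polynomial map sends proportional vectors to proportional vectors. -/
lemma MvPolynomial.IsHomogeneous.eval_smul_vec {σ ι K : Type*} [CommSemiring K] {n : ℕ}
    {p : ι → MvPolynomial σ K} (hp : ∀ i, (p i).IsHomogeneous n) (μ : K) (x : σ → K) :
    (fun k ↦ eval (μ • x) (p k)) = μ ^ n • fun k ↦ eval x (p k) := by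
  ext k
  simp only [eval_eq, Pi.smul_apply, smul_eq_mul, Finset.mul_sum, mul_pow, Finset.prod_mul_distrib,
    Finset.prod_pow_eq_pow_sum]
  refine Finset.sum_congr rfl fun d hd ↦ ?_
  rw [(hp k).degree_eq_sum_deg_support hd, mul_left_comm]

/-- A rational curve of degree 5 having three distinct self-intersections is planar.
Here `p a = (p₀(a), p₁(a), p₂(a), p₃(a)) ∈ ℂ⁴`; a self-intersection is given by
non-proportional parameters `aᵢ, bᵢ` with `p(bᵢ) = λᵢ • p(aᵢ)`, `λᵢ ≠ 0`, `p(aᵢ) ≠ 0`,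
and the three image points `p(aᵢ)` pairwise non-proportional. -/
theorem quintic_with_three_double_points_is_planar
    (p : Fin 4 → MvPolynomial (Fin 2) ℂ)
    (hp : ∀ i, (p i).IsHomogeneous 5)
    (a b : Fin 3 → (Fin 2 → ℂ))
    (ha : ∀ i, a i ≠ 0) (hb : ∀ i, b i ≠ 0)
    (hnotprop : ∀ i, ¬ ∃ μ : ℂ, b i = μ • a i)
    (hpa : ∀ i, (fun j => MvPolynomial.eval (a i) (p j)) ≠ 0)
    (hdbl : ∀ i, ∃ lam : ℂ, lam ≠ 0 ∧
      (fun j => MvPolynomial.eval (b i) (p j)) =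
        lam • (fun j => MvPolynomial.eval (a i) (p j)))
    (himages : ∀ i j, i ≠ j → ¬ ∃ μ : ℂ,
      (fun k => MvPolynomial.eval (a j) (p k)) =
        μ • (fun k => MvPolynomial.eval (a i) (p k))) :
    ∃ c : Fin 4 → ℂ, c ≠ 0 ∧ ∑ i, c i • p i = 0 := by
  choose lam hlam hbl using hdbl
  obtain ⟨c, hc, hc0⟩ : ∃ c : Fin 4 → ℂ, c ≠ 0 ∧ ∀ i, ∑ k, c k * eval (a i) (p k) = 0 := by
    obtain ⟨c, hc, hne⟩ := Submodule.exists_mem_ne_zero_of_ne_bot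
      (LinearMap.ker_ne_bot_of_finrank_lt
        (f := Matrix.mulVecLin (Matrix.of fun i k ↦ eval (a i) (p k))) (by simp))
    refine ⟨c, hne, fun i ↦ ?_⟩
    simpa [Matrix.mulVec, dotProduct, mul_comm] using congr_fun (LinearMap.mem_ker.1 hc) i
  refine ⟨c, hc, ?_⟩
  have hF : (∑ i, c i • p i).IsHomogeneous 5 :=
    IsHomogeneous.sum _ _ _ fun i _ ↦ by
      rw [smul_eq_C_mul]; exact (hp i).C_mul _
  let x : Fin 3 × Fin 2 → Fin 2 → ℂ := fun q ↦ if q.2 = 0 then a q.1 else b q.1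
  have hx0 : ∀ q, x q ≠ 0 := fun q ↦ by
    simp only [x]; split_ifs
    exacts [ha _, hb _]
  have himg : ∀ q, ∃ ν : ℂ, ν ≠ 0 ∧
      (fun k ↦ eval (x q) (p k)) = ν • fun k ↦ eval (a q.1) (p k) := fun q ↦ by
    by_cases hq : q.2 = 0
    · exact ⟨1, one_ne_zero, by simp [x, hq]⟩
    · exact ⟨lam q.1, hlam _, by simpa [x, hq] using hbl q.1⟩
  have hx : ∀ q r, q ≠ r → x r 0 * x q 1 ≠ x q 0 * x r 1 := fun q r hqr h ↦ by
    obtain ⟨μ, hμ⟩ := exists_eq_smul_of_mul_eq_mul (hx0 q) h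
    by_cases h1 : q.1 = r.1
    · obtain ⟨i, e⟩ := q
      obtain ⟨j, f⟩ := r
      obtain rfl : i = j := h1
      fin_cases e <;> fin_cases f
      · exact hqr rfl
      · exact hnotprop i ⟨μ, hμ⟩
      · refine hnotprop i (exists_eq_smul_of_mul_eq_mul (ha i) ?_)
        simpa [x, mul_comm] using h.symm
      · exact hqr rfl
    · obtain ⟨ν, -, hνq⟩ := himg q
      obtain ⟨ρ, hρ, hρr⟩ := himg r
      refine himages q.1 r.1 h1 ⟨ρ⁻¹ * (μ ^ 5 * ν), ?_⟩
      rw [eq_comm, mul_smul, mul_smul, ← hνq, ← IsHomogeneous.eval_smul_vec hp, ← hμ, hρr,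
        inv_smul_smul₀ hρ]
  refine hF.eq_zero_of_fin_two (fun i : Fin 6 ↦ x (finProdFinEquiv.symm i))
    (fun i j hij ↦ hx _ _ fun h ↦ hij (finProdFinEquiv.symm.injective h)) fun i ↦ ?_
  obtain ⟨ν, -, hν⟩ := himg (finProdFinEquiv.symm i)
  have hν' := fun k ↦ congr_fun hν k
  simp only [Pi.smul_apply, smul_eq_mul] at hν'
  simp only [map_sum, smul_eval, hν', mul_left_comm _ ν, ← Finset.mul_sum, hc0, mul_zero]
end

section
/- Let p₀, p₁, p₂, p₃ be binary forms of degree 4 over ℂ, and write p(a) = (p₀(a), p₁(a), p₂(a), p₃(a)) ∈ ℂ⁴ for a ∈ ℂ². Suppose there are vectors a₁, b₁, a₂, b₂ ∈ ℂ² ∖ {0} such that: for each i, aᵢ and bᵢ are not proportional, p(aᵢ) ≠ 0, and p(bᵢ) = λᵢ · p(aᵢ) for some nonzero λᵢ ∈ ℂ; and the vectors p(a₁) and p(a₂) are not proportional. Then the curve is planar: there exists (c₀,c₁,c₂,c₃) ≠ (0,0,0,0) in ℂ⁴ with c₀p₀ + c₁p₁ + c₂p₂ + c₃p₃ = 0 identically.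 (A curve of degree 4 with more than one self-intersection is planar.) -/
open MvPolynomial

/-- More than `d + 1` binary forms of degree `d` are linearly dependent. -/
theorem exists_nontrivial_relation_of_isHomogeneous {K ι : Type*} [Field K] [Fintype ι] {d : ℕ}
    (hcard : d + 1 < Fintype.card ι) (q : ι → MvPolynomial (Fin 2) K)
    (hq : ∀ i, (q i).IsHomogeneous d) :
    ∃ g : ι → K, g ≠ 0 ∧ ∑ i, g i • q i = 0 := by
  let w : ι → Fin (d + 1) → K := fun i k => coeff (Finsupp.equivFunOnFinite.symm ![k, d - k]) (q i)
  have hdep : ¬ LinearIndependent K w := fun h => by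
    have := h.fintype_card_le_finrank
    simp at this
    omega
  obtain ⟨g, hg, i, hi⟩ := Fintype.not_linearIndependent_iff.mp hdep
  refine ⟨g, fun h => hi (congrFun h i), ?_⟩
  have hhom : (∑ i, g i • q i).IsHomogeneous d :=
    IsHomogeneous.sum _ _ _ fun i _ => (homogeneousSubmodule (Fin 2) K d).smul_mem _ (hq i)
  ext m
  by_cases hm : m.degree = d
  · have hdeg : m 0 + m 1 = d := by simpa [Finsupp.degree_eq_sum] using hm
    have hmk : m = Finsupp.equivFunOnFinite.symm ![m 0, d - m 0] := by
      ext j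
      fin_cases j
      · simp
      · simpa using Nat.eq_sub_of_add_eq' hdeg
    have := congrFun hg ⟨m 0, by omega⟩
    simp only [w, Finset.sum_apply, Pi.smul_apply, Pi.zero_apply, ← hmk] at this
    simpa [coeff_sum] using this
  · simpa using hhom.coeff_eq_zero hm

/-- The binary linear form vanishing exactly on the line spanned by `v`. -/
noncomputable def lineForm {K : Type*} [Field K] (v : Fin 2 → K) : MvPolynomial (Fin 2) K :=
  C (v 1) * X 0 - C (v 0) * X 1

theorem lineForm_isHomogeneous {K : Type*} [Field K] (v : Fin 2 → K) :
    (lineForm v).IsHomogeneous 1 :=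
  (isHomogeneous_C_mul_X _ _).sub (isHomogeneous_C_mul_X _ _)

@[simp]
theorem eval_lineForm_self {K : Type*} [Field K] (v : Fin 2 → K) : eval v (lineForm v) = 0 := by
  simp [lineForm, mul_comm]

theorem exists_eq_smul_of_eval_lineForm_eq_zero {K : Type*} [Field K] {v w : Fin 2 → K}
    (hv : v ≠ 0) (h : eval w (lineForm v) = 0) : ∃ μ : K, w = μ • v := by
  simp only [lineForm, map_sub, map_mul, eval_C, eval_X] at h
  by_cases h0 : v 0 = 0
  · have h1 : v 1 ≠ 0 := fun h1 => hv (by ext j; fin_cases j <;> simp [h0, h1])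
    refine ⟨w 1 / v 1, ?_⟩
    ext j
    fin_cases j
    · simpa [h0, h1] using h
    · simp [h1]
  · refine ⟨w 0 / v 0, ?_⟩
    ext j
    fin_cases j
    · simp [h0]
    · simp only [Fin.mk_one, Pi.smul_apply, smul_eq_mul]
      field_simp
      linear_combination -h

theorem eval_smul_of_isHomogeneous {K σ : Type*} [Field K] {d : ℕ} {f : MvPolynomial σ K}
    (hf : f.IsHomogeneous d) (μ : K) (v : σ → K) : eval (μ • v) f = μ ^ d * eval v f := by
  simp only [eval_eq, Finset.mul_sum]
  refine Finset.sum_congr rfl fun m hm => ?_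
  have hdeg : ∑ i ∈ m.support, m i = d := by
    by_contra h
    exact mem_support_iff.mp hm (hf.coeff_eq_zero h)
  simp only [Pi.smul_apply, smul_eq_mul, mul_pow, Finset.prod_mul_distrib,
    Finset.prod_pow_eq_pow_sum, hdeg]
  ring

/-- Parameters `x` and `y` whose images are the distinct points `p(v)` and `p(w)` are not
proportional. -/
theorem eval_lineForm_ne_zero_of_image_ne {K ι : Type*} [Field K] {d : ℕ}
    {p : ι → MvPolynomial (Fin 2) K} (hp : ∀ i, (p i).IsHomogeneous d) {v w x y : Fin 2 → K}
    (hvw : ¬ ∃ μ : K, (fun j => eval w (p j)) = μ • fun j => eval v (p j))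
    (hx : ∃ μ : K, (fun j => eval x (p j)) = μ • fun j => eval v (p j))
    (hy : ∃ μ : K, μ ≠ 0 ∧ (fun j => eval y (p j)) = μ • fun j => eval w (p j))
    (hx0 : x ≠ 0) : eval y (lineForm x) ≠ 0 := by
  intro h
  obtain ⟨c, rfl⟩ := exists_eq_smul_of_eval_lineForm_eq_zero hx0 h
  obtain ⟨μ, hμ⟩ := hx
  obtain ⟨ν, hν, hνw⟩ := hy
  refine hvw ⟨ν⁻¹ * c ^ d * μ, funext fun j => ?_⟩
  have h1 := congrFun hμ j
  have h2 := congrFun hνw j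
  simp only [Pi.smul_apply, smul_eq_mul, eval_smul_of_isHomogeneous (hp j)] at h1 h2 ⊢
  rw [h1] at h2
  field_simp
  linear_combination -h2

/-- A rational curve of degree 4 with two distinct self-intersections is planar.
Here `p a = (p₀(a), p₁(a), p₂(a), p₃(a)) ∈ ℂ⁴`; each self-intersection is given by
non-proportional parameters `aᵢ, bᵢ` with `p(bᵢ) = λᵢ • p(aᵢ)`, `λᵢ ≠ 0`, `p(aᵢ) ≠ 0`,
and the image points `p(a₁)`, `p(a₂)` non-proportional. -/
theorem quartic_with_two_double_points_is_planar
    (p : Fin 4 → MvPolynomial (Fin 2) ℂ)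
    (hp : ∀ i, (p i).IsHomogeneous 4)
    (a b : Fin 2 → (Fin 2 → ℂ))
    (ha : ∀ i, a i ≠ 0) (hb : ∀ i, b i ≠ 0)
    (hnotprop : ∀ i, ¬ ∃ μ : ℂ, b i = μ • a i)
    (hpa : ∀ i, (fun j => MvPolynomial.eval (a i) (p j)) ≠ 0)
    (hdbl : ∀ i, ∃ lam : ℂ, lam ≠ 0 ∧
      (fun j => MvPolynomial.eval (b i) (p j)) =
        lam • (fun j => MvPolynomial.eval (a i) (p j)))
    (himages : ¬ ∃ μ : ℂ,
      (fun k => MvPolynomial.eval (a 1) (p k)) =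
        μ • (fun k => MvPolynomial.eval (a 0) (p k))) :
    ∃ c : Fin 4 → ℂ, c ≠ 0 ∧ ∑ i, c i • p i = 0 := by
  have hself (i : Fin 2) : ∃ μ : ℂ, μ ≠ 0 ∧
      (fun j => eval (a i) (p j)) = μ • fun j => eval (a i) (p j) := ⟨1, one_ne_zero, by simp⟩
  have himages' (i : Fin 2) : ¬ ∃ μ : ℂ,
      (fun k => eval (a i) (p k)) = μ • fun k => eval (a (1 - i)) (p k) := by
    fin_cases i
    · rintro ⟨μ, hμ⟩
      have hμ0 : μ ≠ 0 := by
        rintro rfl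
        exact hpa 0 (by simpa using hμ)
      refine himages ⟨μ⁻¹, ?_⟩
      rw [eq_inv_smul_iff₀ hμ0]
      exact hμ.symm
    · exact himages
  let q : Fin 2 → MvPolynomial (Fin 2) ℂ := fun i =>
    lineForm (b i) ^ 2 * (lineForm (a (1 - i)) * lineForm (b (1 - i)))
  have hq (i : Fin 2) : (q i).IsHomogeneous 4 :=
    ((lineForm_isHomogeneous _).pow 2).mul
      ((lineForm_isHomogeneous _).mul (lineForm_isHomogeneous _))
  have hqa (i : Fin 2) : eval (a i) (q i) ≠ 0 := by
    have hba : eval (a i) (lineForm (b i)) ≠ 0 := fun h => by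
      obtain ⟨μ, hμ⟩ := exists_eq_smul_of_eval_lineForm_eq_zero (hb i) h
      have hμ0 : μ ≠ 0 := by
        rintro rfl
        exact ha i (by simpa using hμ)
      exact hnotprop i ⟨μ⁻¹, by rw [eq_inv_smul_iff₀ hμ0, hμ]⟩
    simp only [q, map_mul, map_pow]
    exact mul_ne_zero (pow_ne_zero 2 hba) (mul_ne_zero
      (eval_lineForm_ne_zero_of_image_ne hp (himages' i) ((hself _).imp fun _ => And.right)
        (hself i) (ha _))
      (eval_lineForm_ne_zero_of_image_ne hp (himages' i) ((hdbl _).imp fun _ => And.right)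
        (hself i) (hb _)))
  have hqb (i : Fin 2) : eval (b i) (q i) = 0 := by simp [q]
  have hqa' (i : Fin 2) : eval (a i) (q (1 - i)) = 0 := by simp [q]
  have hqb' (i : Fin 2) : eval (b i) (q (1 - i)) = 0 := by simp [q]
  obtain ⟨g, hg, hsum⟩ := exists_nontrivial_relation_of_isHomogeneous (d := 4) (by simp)
    (Sum.elim p q) (Sum.rec hp hq)
  rw [Fintype.sum_sum_type] at hsum
  simp only [Sum.elim_inl, Sum.elim_inr] at hsum
  have hpair (f : Fin 2 → MvPolynomial (Fin 2) ℂ) (i : Fin 2) : ∑ j, f j = f i + f (1 - i) := by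
    fin_cases i <;> simp [Fin.sum_univ_two, add_comm]
  have hgq (i : Fin 2) : g (Sum.inr i) = 0 := by
    obtain ⟨lam, hlam, hba⟩ := hdbl i
    rw [hpair _ i] at hsum
    have hA := congrArg (eval (a i)) hsum
    have hB := congrArg (eval (b i)) hsum
    simp only [map_add, map_sum, smul_eval, hqb, hqa', hqb', map_zero, mul_zero, add_zero]
      at hA hB
    have hzero : ∑ j, g (Sum.inl j) * eval (b i) (p j) =
        lam * ∑ j, g (Sum.inl j) * eval (a i) (p j) := by
      rw [Finset.mul_sum]
      refine Finset.sum_congr rfl fun j _ => ?_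
      rw [show eval (b i) (p j) = lam * eval (a i) (p j) from congrFun hba j]
      ring
    rw [hB, zero_eq_mul, or_iff_right hlam] at hzero
    rw [hzero, zero_add] at hA
    exact (mul_eq_zero.mp hA).resolve_right (hqa i)
  refine ⟨fun j => g (Sum.inl j), fun h => hg (funext ?_), ?_⟩
  · rintro (j | i)
    · exact congrFun h j
    · exact hgq i
  · simpa [hgq] using hsum
end

section
/- Let d ≥ 3 and let p₀, p₁, p₂, p₃ be binary forms of degree d over ℝ that are linearly independent over ℝ (i.e., the parametrized curve is nonplanar). Then there exists a nonzero (c₀,c₁,c₂,c₃) ∈ ℝ⁴ such that the binary form g = c₀p₀ + c₁p₁ + c₂p₂ + c₃p₃ is not identically zero and g has a nonreal zero: there exists z ∈ ℂ with nonzero imaginary part such that g(z,1) = 0 (evaluating g over ℂ). (Hence the real plane defined by (c₀,c₁,c₂,c₃) meets the curve of degree d in at most d − 2 real points counted with multiplicity.) -/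
open MvPolynomial

/-- For a nonplanar real rational curve of degree `d ≥ 3` (i.e. the coordinate forms
are linearly independent over `ℝ`), there is a real plane `(c₀,c₁,c₂,c₃) ≠ 0` such that
the binary form `g = ∑ cᵢ pᵢ` is nonzero and has a nonreal zero `z` (so the plane meets
the curve in at most `d - 2` real points counted with multiplicity). -/
theorem exists_plane_with_nonreal_intersection
    (d : ℕ) (hd : 3 ≤ d)
    (p : Fin 4 → MvPolynomial (Fin 2) ℝ)
    (hp : ∀ i, (p i).IsHomogeneous d)
    (hli : LinearIndependent ℝ p) :
    ∃ c : Fin 4 → ℝ, c ≠ 0 ∧ (∑ i, c i • p i) ≠ 0 ∧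
      ∃ z : ℂ, z.im ≠ 0 ∧
        MvPolynomial.aeval ![z, 1] (∑ i, c i • p i) = 0 := by
  let φ : (Fin 4 → ℝ) →ₗ[ℝ] ℂ :=
    (MvPolynomial.aeval (R := ℝ) ![Complex.I, 1]).toLinearMap ∘ₗ Fintype.linearCombination ℝ p
  have hφ : LinearMap.ker φ ≠ ⊥ :=
    LinearMap.ker_ne_bot_of_finrank_lt (by simp [Complex.finrank_real_complex])
  obtain ⟨c, hc, hc0⟩ := Submodule.exists_mem_ne_zero_of_ne_bot hφ
  refine ⟨c, hc0, fun h => hc0 (funext (Fintype.linearIndependent_iff.mp hli c h)),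
    Complex.I, by simp, ?_⟩
  simpa only [φ, LinearMap.mem_ker, LinearMap.comp_apply, AlgHom.toLinearMap_apply,
    Fintype.linearCombination_apply] using hc
end

section
/- Let p₀, p₁, p₂, p₃ be binary forms of degree 3 over ℝ that are linearly independent over ℝ, and write p(a) = (p₀(a), p₁(a), p₂(a), p₃(a)) ∈ ℂ⁴ for a ∈ ℂ² (evaluating the real forms at complex arguments). Then: (i) p(a) ≠ 0 for every a ∈ ℂ² ∖ {0}; and (ii) for all a, b ∈ ℂ² ∖ {0}, if p(a) and p(b) are proportional (i.e., p(b) = λ·p(a) for some λ ∈ ℂ), then a and b are proportional. In other words, the induced map ℙ¹(ℂ) → ℙ³(ℂ) is well defined and injective: a nonplanar rational curve of degree 3 has no double points and is a knot parametrization. -/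
open MvPolynomial

/-- The monomials `X₀ ^ i * X₁ ^ (n - i)` span the binary forms of degree `n`. -/
theorem binaryForm_mem_span_monomials {K : Type*} [Field K] {n : ℕ}
    {q : MvPolynomial (Fin 2) K} (hq : q.IsHomogeneous n) :
    q ∈ Submodule.span K (Set.range fun i : Fin (n + 1) =>
      (X 0 ^ (i : ℕ) * X 1 ^ (n - i) : MvPolynomial (Fin 2) K)) := by
  rw [q.as_sum]
  refine Submodule.sum_mem _ fun d hd => ?_
  have hdeg : d 0 + d 1 = n := by
    simpa [Finsupp.weight_apply, Finsupp.sum_fintype] using hq (mem_support_iff.mp hd)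
  have hmon : monomial d (coeff d q) = coeff d q • (X 0 ^ d 0 * X 1 ^ (n - d 0)) := by
    rw [monomial_eq, Finsupp.prod_fintype _ _ (by simp), Fin.prod_univ_two, smul_eq_C_mul,
      ← hdeg, Nat.add_sub_cancel_left]
  rw [hmon]
  exact Submodule.smul_mem _ _ (Submodule.subset_span ⟨⟨d 0, by omega⟩, rfl⟩)

/-- Any `n + 1` linearly independent binary forms of degree `n` span all forms of degree `n`. -/
theorem binaryForm_mem_span_of_linearIndependent {K : Type*} [Field K] {n : ℕ}
    {p : Fin (n + 1) → MvPolynomial (Fin 2) K} (hp : ∀ i, (p i).IsHomogeneous n)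
    (hli : LinearIndependent K p) {q : MvPolynomial (Fin 2) K} (hq : q.IsHomogeneous n) :
    q ∈ Submodule.span K (Set.range p) := by
  have hle : Submodule.span K (Set.range p) ≤
      Submodule.span K (Set.range fun i : Fin (n + 1) =>
        (X 0 ^ (i : ℕ) * X 1 ^ (n - i) : MvPolynomial (Fin 2) K)) := by
    rw [Submodule.span_le]
    rintro _ ⟨i, rfl⟩
    exact binaryForm_mem_span_monomials (hp i)
  have : FiniteDimensional K (Submodule.span K (Set.range fun i : Fin (n + 1) =>
      (X 0 ^ (i : ℕ) * X 1 ^ (n - i) : MvPolynomial (Fin 2) K))) :=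
    FiniteDimensional.span_of_finite K (Set.finite_range _)
  rw [Submodule.eq_of_le_of_finrank_le hle
    ((finrank_range_le_card _).trans (finrank_span_eq_card hli).ge)]
  exact binaryForm_mem_span_monomials hq

/-- A proportionality between the values at `a` and `b` of a maximal linearly independent family
of binary forms of degree `n` holds for every binary form of degree `n`. -/
theorem aeval_binaryForm_eq_mul_of_linearIndependent {K L : Type*} [Field K] [CommRing L]
    [Algebra K L] {n : ℕ} {p : Fin (n + 1) → MvPolynomial (Fin 2) K}
    (hp : ∀ i, (p i).IsHomogeneous n) (hli : LinearIndependent K p) {a b : Fin 2 → L} {c : L}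
    (h : ∀ i, aeval b (p i) = c * aeval a (p i)) {q : MvPolynomial (Fin 2) K}
    (hq : q.IsHomogeneous n) : aeval b q = c * aeval a q := by
  have hspan : Submodule.span K (Set.range p) ≤ LinearMap.eqLocus
      (aeval b : MvPolynomial (Fin 2) K →ₐ[K] L).toLinearMap
      (LinearMap.mulLeft K c ∘ₗ (aeval a : MvPolynomial (Fin 2) K →ₐ[K] L).toLinearMap) := by
    rw [Submodule.span_le]
    rintro _ ⟨i, rfl⟩
    exact h i
  exact hspan (binaryForm_mem_span_of_linearIndependent hp hli hq)

/-- A nonplanar real rational curve of degree 3 has no double points: if the real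
binary forms `p₀,…,p₃` of degree 3 are linearly independent over `ℝ`, then evaluating
over `ℂ`, (i) `p(a) ≠ 0` for every `a ∈ ℂ² \ {0}`, and (ii) if `p(a)` and `p(b)` are
proportional for nonzero `a, b`, then `a` and `b` are proportional; hence the induced
map `ℙ¹(ℂ) → ℙ³(ℂ)` is well defined and injective. -/
theorem nonplanar_cubic_is_knot_parametrization
    (p : Fin 4 → MvPolynomial (Fin 2) ℝ)
    (hp : ∀ i, (p i).IsHomogeneous 3)
    (hli : LinearIndependent ℝ p) :
    (∀ a : Fin 2 → ℂ, a ≠ 0 → (fun i => MvPolynomial.aeval a (p i)) ≠ 0) ∧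
    (∀ a b : Fin 2 → ℂ, a ≠ 0 → b ≠ 0 →
      (∃ lam : ℂ, (fun i => MvPolynomial.aeval b (p i)) =
        lam • (fun i => MvPolynomial.aeval a (p i))) →
      ∃ μ : ℂ, b = μ • a) := by
  have key : ∀ (a b : Fin 2 → ℂ) (c : ℂ), (∀ i, aeval b (p i) = c * aeval a (p i)) →
      ∀ i j k, b i * b j * b k = c * (a i * a j * a k) := by
    intro a b c h i j k
    simpa using aeval_binaryForm_eq_mul_of_linearIndependent hp hli h
      (((isHomogeneous_X ℝ i).mul (isHomogeneous_X ℝ j)).mul (isHomogeneous_X ℝ k))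
  have nonzero : ∀ a : Fin 2 → ℂ, a ≠ 0 → (fun i => aeval a (p i)) ≠ 0 := by
    intro a ha h
    refine ha (funext fun i => ?_)
    simpa using key a a 0 (fun j => by simpa using congrFun h j) i i i
  refine ⟨nonzero, fun a b ha hb ⟨c, h⟩ => ?_⟩
  have hk := key a b c fun i => congrFun h i
  have hc : c ≠ 0 := by
    rintro rfl
    exact nonzero b hb (by simpa using h)
  obtain ⟨i, hi⟩ := Function.ne_iff.mp ha
  have hi : a i ≠ 0 := hi
  have hbi : b i ≠ 0 := by
    intro h0
    have := hk i i i
    simp [h0, hc, hi] at this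
  refine ⟨b i / a i, funext fun j => ?_⟩
  have hj : b j * a i = b i * a j := by
    refine mul_left_cancel₀ (mul_ne_zero hbi hbi) ?_
    linear_combination a i * hk i i j - a j * hk i i i
  simp only [Pi.smul_apply, smul_eq_mul]
  field_simp
  exact hj
end

section
/- Let p₀, p₁, p₂, p₃ be binary forms of degree 2 over ℝ, write p(a) = (p₀(a), p₁(a), p₂(a), p₃(a)) ∈ ℝ⁴ for a ∈ ℝ², and assume: (i) p(a) ≠ 0 for every a ∈ ℝ² ∖ {0}; and (ii) the induced map on ℝP¹ is injective, i.e., for all a, b ∈ ℝ² ∖ {0}, if p(a) and p(b) are proportional then a and b are proportional. Then there exists an invertible real 4×4 matrix A such that applying A to the column vector (p₀, p₁, p₂, p₃) yields the quadruple (t², ts, s², 0). (Up to a real projective transformation, every rational knot of degree 2 is the standard circle/conic.) -/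
open MvPolynomial

/-- The coefficients of a binary quadratic form, along `t²`, `ts`, `s²`. -/
noncomputable def quadCoeff (q : MvPolynomial (Fin 2) ℝ) : Fin 3 → ℝ :=
  ![q.coeff (Finsupp.single 0 2), q.coeff (Finsupp.single 0 1 + Finsupp.single 1 1),
    q.coeff (Finsupp.single 1 2)]

theorem eq_quadCoeff_of_isHomogeneous {q : MvPolynomial (Fin 2) ℝ} (hq : q.IsHomogeneous 2) :
    q = quadCoeff q 0 • (X 0 : MvPolynomial (Fin 2) ℝ) ^ 2 + quadCoeff q 1 • (X 0 * X 1)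
      + quadCoeff q 2 • X 1 ^ 2 := by
  have h11 : (X 0 * X 1 : MvPolynomial (Fin 2) ℝ) =
      monomial (Finsupp.single 0 1 + Finsupp.single 1 1) 1 := by
    simp [X, monomial_mul]
  rw [h11, X_pow_eq_monomial, X_pow_eq_monomial]
  ext d
  simp only [coeff_add, coeff_smul, coeff_monomial, smul_eq_mul]
  have hd : ∀ e : Fin 2 →₀ ℕ, e = d ↔ e 0 = d 0 ∧ e 1 = d 1 := fun e => by
    rw [Finsupp.ext_iff, Fin.forall_fin_two]
  by_cases h2 : d 0 + d 1 = 2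
  · have hcases : d 0 = 2 ∧ d 1 = 0 ∨ d 0 = 1 ∧ d 1 = 1 ∨ d 0 = 0 ∧ d 1 = 2 := by omega
    rcases hcases with h | h | h
    · obtain rfl := (hd (Finsupp.single 0 2)).2 (by simp [h])
      simp [Finsupp.ext_iff, Fin.forall_fin_two, quadCoeff]
    · obtain rfl := (hd (Finsupp.single 0 1 + Finsupp.single 1 1)).2 (by simp [h])
      simp [Finsupp.ext_iff, Fin.forall_fin_two, quadCoeff]
    · obtain rfl := (hd (Finsupp.single 1 2)).2 (by simp [h])
      simp [Finsupp.ext_iff, Fin.forall_fin_two, quadCoeff]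
  · rw [hq.coeff_eq_zero (by simpa [Finsupp.degree_eq_sum] using h2)]
    have h20 : Finsupp.single 0 2 ≠ d := by rintro rfl; simp at h2
    have h11 : Finsupp.single 0 1 + Finsupp.single 1 1 ≠ d := by rintro rfl; simp at h2
    have h02 : Finsupp.single 1 2 ≠ d := by rintro rfl; simp at h2
    simp [h20, h11, h02]

theorem eval_eq_quadCoeff {q : MvPolynomial (Fin 2) ℝ} (hq : q.IsHomogeneous 2)
    (a : Fin 2 → ℝ) :
    eval a q = quadCoeff q 0 * a 0 ^ 2 + quadCoeff q 1 * (a 0 * a 1)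
      + quadCoeff q 2 * a 1 ^ 2 := by
  conv_lhs => rw [eq_quadCoeff_of_isHomogeneous hq]
  simp [smul_eval]

/-- A nonzero linear relation between the coefficient columns would make two distinct points of
the projective line have proportional images. -/
theorem linearIndependent_quadCoeff {ι : Type*} (p : ι → MvPolynomial (Fin 2) ℝ)
    (hp : ∀ i, (p i).IsHomogeneous 2)
    (hinj : ∀ a b : Fin 2 → ℝ, a ≠ 0 → b ≠ 0 →
      (∃ lam : ℝ, (fun i => eval b (p i)) = lam • (fun i => eval a (p i))) →
      ∃ μ : ℝ, b = μ • a) :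
    LinearIndependent ℝ (fun (k : Fin 3) (i : ι) => quadCoeff (p i) k) := by
  rw [Fintype.linearIndependent_iff]
  intro v hv
  have hv' : ∀ i, v 0 * quadCoeff (p i) 0 + v 1 * quadCoeff (p i) 1
      + v 2 * quadCoeff (p i) 2 = 0 := fun i => by
    simpa [Fin.sum_univ_three] using congrFun hv i
  have hx : v 0 = 0 := by
    by_contra hx
    obtain ⟨μ, hμ⟩ := hinj ![0, 1] ![v 0, v 1] (by simp) (by simp [hx])
      ⟨-(v 0 * v 2 - v 1 ^ 2), by
        ext i
        simp only [eval_eq_quadCoeff (hp i), Pi.smul_apply, smul_eq_mul, Matrix.cons_val_zero,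
          Matrix.cons_val_one]
        linear_combination v 0 * hv' i⟩
    exact hx (by simpa using congrFun hμ 0)
  have hz : v 2 = 0 := by
    by_contra hz
    obtain ⟨μ, hμ⟩ := hinj ![1, 0] ![v 1, v 2] (by simp) (by simp [hz])
      ⟨-(v 0 * v 2 - v 1 ^ 2), by
        ext i
        simp only [eval_eq_quadCoeff (hp i), Pi.smul_apply, smul_eq_mul, Matrix.cons_val_zero,
          Matrix.cons_val_one]
        linear_combination v 2 * hv' i⟩
    exact hz (by simpa using congrFun hμ 1)
  have hy : v 1 = 0 := by
    by_contra hy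
    have hc : ∀ i, quadCoeff (p i) 1 = 0 := fun i => by simpa [hx, hz, hy] using hv' i
    obtain ⟨μ, hμ⟩ := hinj ![1, 1] ![1, -1] (by simp) (by simp)
      ⟨1, by ext i; simp [eval_eq_quadCoeff (hp i), hc i]⟩
    have e0 : 1 = μ := by simpa using congrFun hμ 0
    have e1 : -1 = μ := by simpa using congrFun hμ 1
    linarith
  intro k
  fin_cases k <;> assumption

/-- Up to a real projective transformation, every rational knot of degree 2 is the
standard conic: if the real binary forms `p₀,…,p₃` of degree 2 never vanish
simultaneously on `ℝ² \ {0}` and the induced map on `ℝP¹` is injective, then some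
invertible real 4×4 matrix takes `(p₀,p₁,p₂,p₃)` to `(t², ts, s², 0)`. -/
theorem degree_two_knot_is_standard_conic
    (p : Fin 4 → MvPolynomial (Fin 2) ℝ)
    (hp : ∀ i, (p i).IsHomogeneous 2)
    (h0 : ∀ a : Fin 2 → ℝ, a ≠ 0 → (fun i => MvPolynomial.eval a (p i)) ≠ 0)
    (hinj : ∀ a b : Fin 2 → ℝ, a ≠ 0 → b ≠ 0 →
      (∃ lam : ℝ, (fun i => MvPolynomial.eval b (p i)) =
        lam • (fun i => MvPolynomial.eval a (p i))) →
      ∃ μ : ℝ, b = μ • a) :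
    ∃ A : Matrix (Fin 4) (Fin 4) ℝ, IsUnit A ∧
      (fun i => ∑ j, A i j • p j) =
        ![(X 0 : MvPolynomial (Fin 2) ℝ) ^ 2, X 0 * X 1, X 1 ^ 2, 0] := by
  obtain ⟨w, hw⟩ := exists_linearIndependent_snoc_of_lt_finrank
    (linearIndependent_quadCoeff p hp hinj) (by simp)
  set c : Fin 4 → Fin 4 → ℝ := Fin.snoc (fun (k : Fin 3) (i : Fin 4) => quadCoeff (p i) k) w
    with hc
  set B : Matrix (Fin 4) (Fin 4) ℝ := (Matrix.of c).transpose with hB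
  have hBu : IsUnit B := Matrix.linearIndependent_cols_iff_isUnit.1 hw
  set m : Fin 4 → MvPolynomial (Fin 2) ℝ := ![X 0 ^ 2, X 0 * X 1, X 1 ^ 2, 0] with hm
  have hpm : ∀ j, p j = ∑ k, B j k • m k := fun j => by
    conv_lhs => rw [eq_quadCoeff_of_isHomogeneous (hp j)]
    rw [Fin.sum_univ_castSucc, Fin.sum_univ_three]
    have hBk : ∀ k : Fin 3, B j k.castSucc = quadCoeff (p j) k := fun k => by
      simp only [hB, hc, Matrix.transpose_apply, Matrix.of_apply, Fin.snoc_castSucc]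
    rw [hBk, hBk, hBk]
    simp [hm]
  have hdet : IsUnit B.det := (Matrix.isUnit_iff_isUnit_det B).1 hBu
  refine ⟨B⁻¹, Matrix.isUnit_nonsing_inv_iff.2 hBu, ?_⟩
  funext i
  calc ∑ j, B⁻¹ i j • p j = ∑ j, ∑ k, (B⁻¹ i j * B j k) • m k :=
        Finset.sum_congr rfl fun j _ => by
          conv_lhs => rw [hpm j]
          simp only [Finset.smul_sum, smul_smul]
    _ = ∑ k, (B⁻¹ * B) i k • m k := by
        rw [Finset.sum_comm]
        simp only [Matrix.mul_apply, Finset.sum_smul]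
    _ = m i := by
        rw [Matrix.nonsing_inv_mul B hdet]
        simp [Matrix.one_apply]
end

section
/- Let p₀, p₁, p₂, p₃ be binary forms of degree 4 over ℝ that are linearly independent over ℝ, and suppose: p₀, p₁, p₂ all vanish at (1,0) and at (0,1), while p₃(1,0) ≠ 0 and p₃(0,1) ≠ 0 (the curve has a double point at (0:0:0:1) with parameters (1:0) and (0:1)). Then there exist an invertible real 4×4 matrix A, nonzero reals λ, μ, and signs ε₁, ε₂ ∈ {1, −1}, such that applying A to the column vector (p₀,p₁,p₂,p₃) and then substituting (t,s) ↦ (λt, μs) yields exactly the quadruple (ts³, t²s², t³s, ε₁t⁴ + ε₂s⁴). (Every nonplanar degree-4 curve with a real double point can be put in one of the four standard wall forms P(t:s) = (ts³ : t²s² : t³s : ±t⁴ ± s⁴).) -/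
open MvPolynomial

/-- A binary form of degree `n` is a linear combination of the monomials `X 0 ^ k * X 1 ^ (n - k)`. -/
theorem MvPolynomial.IsHomogeneous.exists_eq_sum_binary {R : Type*} [CommSemiring R] {n : ℕ}
    {p : MvPolynomial (Fin 2) R} (hp : p.IsHomogeneous n) :
    ∃ c : ℕ → R, p = ∑ k ∈ Finset.range (n + 1), c k • (X 0 ^ k * X 1 ^ (n - k)) := by
  classical
  have key (k l : ℕ) : (X 0 ^ k * X 1 ^ l : MvPolynomial (Fin 2) R) =
      monomial (Finsupp.single 0 k + Finsupp.single 1 l) 1 := by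
    simp [X_pow_eq_monomial, monomial_mul]
  refine ⟨fun k => coeff (Finsupp.single 0 k + Finsupp.single 1 (n - k)) p, ?_⟩
  ext d
  simp only [key, coeff_sum, coeff_smul, coeff_monomial, smul_eq_mul, mul_ite, mul_one, mul_zero]
  have hd : d = Finsupp.single 0 (d 0) + Finsupp.single 1 (d 1) := by
    ext i; fin_cases i <;> simp
  have hdeg : d.degree = d 0 + d 1 := by
    simp [Finsupp.degree_eq_sum]
  by_cases h : d 0 + d 1 = n
  · have h1 : n - d 0 = d 1 := by omega
    rw [Finset.sum_eq_single (d 0)]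
    · rw [h1, ← hd, if_pos rfl]
    · intro k _ hk
      refine if_neg fun e => hk ?_
      rw [← e]; simp
    · intro hk
      simp only [Finset.mem_range] at hk
      omega
  · rw [hp.coeff_eq_zero (by rwa [hdeg]), Finset.sum_eq_zero]
    intro k hk
    refine if_neg fun e => h ?_
    simp only [Finset.mem_range] at hk
    rw [← e]
    simp
    omega

/-- Every nonzero real number can be scaled to a sign by a fourth power. -/
theorem exists_pow_four_mul_eq_sign {a : ℝ} (ha : a ≠ 0) :
    ∃ l e : ℝ, l ≠ 0 ∧ (e = 1 ∨ e = -1) ∧ l ^ 4 * a = e := by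
  have habs : 0 < |a|⁻¹ := by positivity
  have hl : (|a|⁻¹ ^ ((4 : ℕ) : ℝ)⁻¹) ^ 4 = |a|⁻¹ := Real.rpow_inv_natCast_pow habs.le (by norm_num)
  refine ⟨|a|⁻¹ ^ ((4 : ℕ) : ℝ)⁻¹, |a|⁻¹ * a, (Real.rpow_pos_of_pos habs _).ne', ?_, by rw [hl]⟩
  rcases abs_choice a with h | h <;> rw [h]
  · exact .inl (inv_mul_cancel₀ ha)
  · right; field_simp

/-- Every nonplanar real rational curve of degree 4 with a real double point at
`(0:0:0:1)` with parameters `(1:0)` and `(0:1)` can be put in one of the four standard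
wall forms `P(t:s) = (ts³ : t²s² : t³s : ±t⁴ ± s⁴)` by an invertible real projective
transformation together with a reparametrization `(t,s) ↦ (λt, μs)`, `λ, μ ≠ 0`. -/
theorem quartic_wall_normal_form
    (p : Fin 4 → MvPolynomial (Fin 2) ℝ)
    (hp : ∀ i, (p i).IsHomogeneous 4)
    (hli : LinearIndependent ℝ p)
    (h10 : ∀ i : Fin 4, i ≠ 3 → MvPolynomial.eval ![(1 : ℝ), 0] (p i) = 0)
    (h01 : ∀ i : Fin 4, i ≠ 3 → MvPolynomial.eval ![(0 : ℝ), 1] (p i) = 0)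
    (h3a : MvPolynomial.eval ![(1 : ℝ), 0] (p 3) ≠ 0)
    (h3b : MvPolynomial.eval ![(0 : ℝ), 1] (p 3) ≠ 0) :
    ∃ (A : Matrix (Fin 4) (Fin 4) ℝ) (lam mu e₁ e₂ : ℝ),
      IsUnit A ∧ lam ≠ 0 ∧ mu ≠ 0 ∧
      (e₁ = 1 ∨ e₁ = -1) ∧ (e₂ = 1 ∨ e₂ = -1) ∧
      (fun i => MvPolynomial.aeval
          ![lam • (X 0 : MvPolynomial (Fin 2) ℝ), mu • X 1]
          (∑ j, A i j • p j)) =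
        ![X 0 * X 1 ^ 3, X 0 ^ 2 * X 1 ^ 2, X 0 ^ 3 * X 1,
          e₁ • X 0 ^ 4 + e₂ • X 1 ^ 4] := by
  choose c hc using fun i => (hp i).exists_eq_sum_binary
  simp only [Finset.sum_range_succ, Finset.sum_range_zero, zero_add] at hc
  have e10 (i) : eval ![(1 : ℝ), 0] (p i) = c i 4 := by
    rw [hc]; simp [smul_eval]
  have e01 (i) : eval ![(0 : ℝ), 1] (p i) = c i 0 := by
    rw [hc]; simp [smul_eval]
  simp only [e10, e01] at h10 h01 h3a h3b
  obtain ⟨lam, e₁, hlam, he₁, hlam4⟩ := exists_pow_four_mul_eq_sign h3a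
  obtain ⟨mu, e₂, hmu, he₂, hmu4⟩ := exists_pow_four_mul_eq_sign h3b
  let q : Fin 4 → MvPolynomial (Fin 2) ℝ :=
    ![X 0 * X 1 ^ 3, X 0 ^ 2 * X 1 ^ 2, X 0 ^ 3 * X 1, c 3 4 • X 0 ^ 4 + c 3 0 • X 1 ^ 4]
  let M : Matrix (Fin 4) (Fin 4) ℝ :=
    Matrix.of fun i => ![c i 1, c i 2, c i 3, if i = 3 then 1 else 0]
  have hM (i) : p i = ∑ j, M i j • q j := by
    rw [hc i]
    by_cases hi : i = 3
    · subst hi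
      simp [M, q, Fin.sum_univ_four]
      abel
    · simp [M, q, Fin.sum_univ_four, hi, h10 i hi, h01 i hi]
  have hMu : IsUnit M := by
    rw [← Matrix.linearIndependent_rows_iff_isUnit]
    have hcomp : Fintype.linearCombination ℝ q ∘ M.row = p :=
      funext fun i => (hM i).symm
    exact LinearIndependent.of_comp (Fintype.linearCombination ℝ q) (by rwa [hcomp])
  have hq (i) : ∑ j, M⁻¹ i j • p j = q i := by
    have hinv : M⁻¹ * M = 1 := Matrix.nonsing_inv_mul _ ((Matrix.isUnit_iff_isUnit_det _).1 hMu)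
    simp only [hM, Finset.smul_sum, smul_smul]
    rw [Finset.sum_comm]
    simp only [← Finset.sum_smul, ← Matrix.mul_apply, hinv]
    simp [Matrix.one_apply]
  let D : Fin 4 → ℝ := ![(lam * mu ^ 3)⁻¹, (lam ^ 2 * mu ^ 2)⁻¹, (lam ^ 3 * mu)⁻¹, 1]
  have hD : IsUnit (Matrix.diagonal D) := by
    rw [Matrix.isUnit_diagonal, Pi.isUnit_iff]
    intro i
    fin_cases i <;> simp [D, hlam, hmu]
  refine ⟨Matrix.diagonal D * M⁻¹, lam, mu, e₁, e₂,
    hD.mul ((Matrix.isUnit_nonsing_inv_iff).2 hMu), hlam, hmu, he₁, he₂, ?_⟩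
  ext1 i
  simp only [Matrix.diagonal_mul, mul_smul, ← Finset.smul_sum, hq]
  fin_cases i
  iterate 3
    · simp [D, q, smul_pow, smul_smul]
      field_simp
      simp
  · simp [D, q, smul_pow, smul_smul, ← hlam4, ← hmu4, mul_comm]
end
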